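/- Let g, h : ℝ → ℝ be bounded Lipschitz continuous functions with g(y) ≥ ε₀ > 0 for all y and |h(y)| ≤ M for all y. For σ > 0 define the Gaussian mollifications g_σ = g ∗ φ_σ and h_σ = h ∗ φ_σ (so g_σ ≥ ε₀ as well). Fix y ∈ ℝ. Then there exists a function E : (0,∞) → ℝ that is monotonically decreasing with E(x) → 0 as x → ∞, such that for every σ > 0, E_{w ∼ N(y, σ²)}[ (h_σ(w)/g_σ(w) − h(y)/g(y))² ] ≤ E(1/σ), where the expectation is over w drawn from the Gaussian distribution with mean y and variance σ². -/

import Mathlib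

open MeasureTheory Filter Topology

/-- The density of the centered Gaussian distribution on `ℝ` with variance `σ²`. -/
noncomputable def gaussPDF (σ x : ℝ) : ℝ :=
  (Real.sqrt (2 * Real.pi * σ ^ 2))⁻¹ * Real.exp (-x ^ 2 / (2 * σ ^ 2))

open ProbabilityTheory

lemma gaussPDF_sub_eq_gaussianPDFReal (σ w z : ℝ) :
    gaussPDF σ (w - z) = gaussianPDFReal w (σ ^ 2).toNNReal z := by
  rw [gaussPDF, gaussianPDFReal, Real.coe_toNNReal _ (sq_nonneg σ), ← neg_sub z w, neg_sq]

lemma integral_mul_gaussPDF_sub {σ : ℝ} (hσ : 0 < σ) (f : ℝ → ℝ) (w : ℝ) :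
    ∫ z, f z * gaussPDF σ (w - z) = ∫ z, f z ∂gaussianReal w (σ ^ 2).toNNReal := by
  rw [integral_gaussianReal_eq_integral_smul (by positivity)]
  simp only [gaussPDF_sub_eq_gaussianPDFReal, smul_eq_mul, mul_comm]

lemma integrable_sub_sq_gaussianReal (w y : ℝ) (v : NNReal) :
    Integrable (fun z => (z - y) ^ 2) (gaussianReal w v) :=
  ((memLp_id_gaussianReal (μ := w) (v := v) 2).sub (memLp_const y)).integrable_sq

lemma integral_sub_sq_gaussianReal (w y : ℝ) (v : NNReal) :
    ∫ z, (z - y) ^ 2 ∂gaussianReal w v = v + (w - y) ^ 2 := by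
  have hvar := variance_eq_sub
    ((memLp_id_gaussianReal (μ := w) (v := v) 2).sub (memLp_const y))
  have hmean : ∫ z, (z - y) ∂gaussianReal w v = w - y := by
    rw [integral_sub (f := fun z => z) ((memLp_id_gaussianReal (μ := w) (v := v) 1).integrable le_rfl)
      (integrable_const y)]
    simp
  have hshift : Var[id - (fun _ => y); gaussianReal w v] = v := by
    have := variance_sub_const (X := id) (μ := gaussianReal w v)
      aestronglyMeasurable_id y
    rw [variance_id_gaussianReal] at this
    exact this
  rw [hshift] at hvar
  simp only [Pi.pow_apply, Pi.sub_apply, id_eq, hmean] at hvar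
  linarith

lemma sq_integral_le_integral_sq {Ω : Type*} [MeasurableSpace Ω] {μ : Measure Ω}
    [IsProbabilityMeasure μ] {f : Ω → ℝ} (hf : MemLp f 2 μ) :
    (∫ x, f x ∂μ) ^ 2 ≤ ∫ x, f x ^ 2 ∂μ := by
  have h := variance_eq_sub hf
  have h0 := variance_nonneg f μ
  simp only [Pi.pow_apply] at h
  linarith

/-- A bounded Lipschitz function vanishing at `y` has small Gaussian average near `y`. -/
lemma sq_integral_gaussianReal_le_of_lipschitz {f : ℝ → ℝ} {y C L : ℝ} (hcont : Continuous f)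
    (hbdd : ∀ z, |f z| ≤ C) (hlip : ∀ z, |f z| ≤ L * |z - y|) (w : ℝ) (v : NNReal) :
    (∫ z, f z ∂gaussianReal w v) ^ 2 ≤ L ^ 2 * (v + (w - y) ^ 2) := by
  have hmem : MemLp f 2 (gaussianReal w v) :=
    MemLp.of_bound hcont.aestronglyMeasurable C (.of_forall hbdd)
  refine (sq_integral_le_integral_sq hmem).trans ?_
  rw [← integral_sub_sq_gaussianReal, ← integral_const_mul]
  refine integral_mono hmem.integrable_sq ((integrable_sub_sq_gaussianReal w y v).const_mul _)
    fun z => ?_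
  have := pow_le_pow_left₀ (abs_nonneg _) (hlip z) 2
  rwa [mul_pow, sq_abs, sq_abs] at this

lemma sq_integral_div_integral_sub_le {g h : ℝ → ℝ} {ε₀ M Mg : ℝ} (hε₀ : 0 < ε₀)
    {Lg Lh : NNReal} (hg_lip : LipschitzWith Lg g) (hh_lip : LipschitzWith Lh h)
    (hg_lb : ∀ z, ε₀ ≤ g z) (hg_bdd : ∀ z, |g z| ≤ Mg) (hh_bdd : ∀ z, |h z| ≤ M)
    (y w : ℝ) (v : NNReal) :
    ((∫ z, h z ∂gaussianReal w v) / (∫ z, g z ∂gaussianReal w v) - h y / g y) ^ 2 ≤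
      ((Lh + |h y / g y| * Lg) / ε₀) ^ 2 * (v + (w - y) ^ 2) := by
  set r := h y / g y with hr
  have hgy : 0 < g y := hε₀.trans_le (hg_lb y)
  have hgi : Integrable g (gaussianReal w v) :=
    .of_bound hg_lip.continuous.aestronglyMeasurable Mg (.of_forall hg_bdd)
  have hhi : Integrable h (gaussianReal w v) :=
    .of_bound hh_lip.continuous.aestronglyMeasurable M (.of_forall hh_bdd)
  have hG : ε₀ ≤ ∫ z, g z ∂gaussianReal w v := by
    simpa using integral_mono (integrable_const ε₀) hgi hg_lb
  have hnum : (∫ z, (h z - r * g z) ∂gaussianReal w v) ^ 2 ≤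
      (Lh + |r| * Lg) ^ 2 * (v + (w - y) ^ 2) := by
    refine sq_integral_gaussianReal_le_of_lipschitz (f := fun z => h z - r * g z)
      (C := M + |r| * Mg)
      (hh_lip.continuous.sub (continuous_const.mul hg_lip.continuous)) (fun z => ?_)
      (fun z => ?_) w v
    · refine (abs_sub _ _).trans ?_
      rw [abs_mul]
      have := hh_bdd z
      have := hg_bdd z
      gcongr
    · have hzero : h z - r * g z = (h z - h y) - r * (g z - g y) := by
        rw [hr]; field_simp; ring
      have h1 : |h z - h y| ≤ Lh * |z - y| := hh_lip.dist_le_mul z y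
      have h2 : |g z - g y| ≤ Lg * |z - y| := hg_lip.dist_le_mul z y
      rw [hzero, add_mul, mul_assoc]
      refine (abs_sub _ _).trans ?_
      rw [abs_mul]
      gcongr
  rw [integral_sub hhi (hgi.const_mul r), integral_const_mul] at hnum
  have hG0 := hε₀.trans_le hG
  rw [div_sub' hG0.ne', div_pow, div_pow, div_mul_eq_mul_div, mul_comm _ r]
  gcongr

/-- scalar form of Theorem 3 of the paper: mean-square approximation
error of the multi-speed conditional score.  For bounded Lipschitz `g, h : ℝ → ℝ` with
`g ≥ ε₀ > 0` and `|h| ≤ M`, with Gaussian mollifications `g_σ = g ∗ φ_σ`,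
`h_σ = h ∗ φ_σ`, and a fixed `y`, there is a function `E : (0,∞) → ℝ` monotonically
decreasing to `0` such that for every `σ > 0`,
`E_{w ∼ N(y,σ²)}[(h_σ(w)/g_σ(w) − h(y)/g(y))²] ≤ E(1/σ)`. -/
theorem mean_square_score_approximation_error
    (g h : ℝ → ℝ) (ε₀ M Mg : ℝ) (hε₀ : 0 < ε₀)
    (Lg Lh : NNReal)
    (hg_lip : LipschitzWith Lg g) (hh_lip : LipschitzWith Lh h)
    (hg_lb : ∀ z, ε₀ ≤ g z) (hg_bdd : ∀ z, |g z| ≤ Mg)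
    (hh_bdd : ∀ z, |h z| ≤ M)
    (y : ℝ) :
    ∃ E : ℝ → ℝ, AntitoneOn E (Set.Ioi 0) ∧ Tendsto E atTop (𝓝 0) ∧
      ∀ σ : ℝ, 0 < σ →
        (∫ w : ℝ,
            ((∫ z : ℝ, h z * gaussPDF σ (w - z)) / (∫ z : ℝ, g z * gaussPDF σ (w - z))
              - h y / g y) ^ 2 * gaussPDF σ (w - y))
          ≤ E (1 / σ) := by
  set K := (Lh + |h y / g y| * Lg) / ε₀
  refine ⟨fun x => 2 * K ^ 2 / x ^ 2, fun a ha b _ hab => ?_, ?_, fun σ hσ => ?_⟩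
  · have : (0 : ℝ) < a := ha
    dsimp only
    gcongr
  · exact tendsto_const_nhds.div_atTop (tendsto_pow_atTop two_ne_zero)
  have hsymm (w : ℝ) : gaussPDF σ (w - y) = gaussPDF σ (y - w) := by
    rw [gaussPDF, gaussPDF, ← neg_sub y w, neg_sq]
  simp_rw [hsymm, integral_mul_gaussPDF_sub hσ]
  have hint : Integrable (fun w => K ^ 2 * (((σ ^ 2).toNNReal : ℝ) + (w - y) ^ 2))
      (gaussianReal y (σ ^ 2).toNNReal) :=
    ((integrable_const _).add (integrable_sub_sq_gaussianReal y y _)).const_mul _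
  refine (integral_mono_of_nonneg (.of_forall fun w => sq_nonneg _) hint (.of_forall fun w =>
    sq_integral_div_integral_sub_le hε₀ hg_lip hh_lip hg_lb hg_bdd hh_bdd y w _)).trans_eq ?_
  rw [integral_const_mul, integral_add (integrable_const _) (integrable_sub_sq_gaussianReal y y _),
    integral_sub_sq_gaussianReal, Real.coe_toNNReal _ (sq_nonneg σ)]
  simp
  ring
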